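/- arXiv:1804.07454 — 13 statements merged into one kernel-verified Lean document; each statement's English description precedes it below -/
import Mathlib

section
/- Let $\{X_\alpha\}_{\alpha\in A}$ be a family of topological spaces each of which is sequentially pracompact. Then the product space $\prod_{\alpha\in A} X_\alpha$ is sequentially pracompact. -/
def SeqPracompact (X : Type*) [TopologicalSpace X] : Prop :=
  ∃ D : Set X, Dense D ∧ ∀ u : ℕ → X, (∀ n, u n ∈ D) →
    ∃ φ : ℕ → ℕ, StrictMono φ ∧ ∃ x : X, Filter.Tendsto (u ∘ φ) Filter.atTop (nhds x)

/-- A diagonal extraction: if, for each `k`, every subsequence of `u k` has a convergent further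
subsequence, then a single subsequence makes all the `u k` converge. -/
theorem exists_strictMono_forall_tendsto {Y : ℕ → Type*} [∀ k, TopologicalSpace (Y k)]
    (u : ∀ k, ℕ → Y k)
    (h : ∀ k, ∀ φ : ℕ → ℕ, ∃ ψ : ℕ → ℕ, StrictMono ψ ∧
      ∃ y : Y k, Filter.Tendsto (u k ∘ φ ∘ ψ) Filter.atTop (nhds y)) :
    ∃ φ : ℕ → ℕ, StrictMono φ ∧
      ∀ k, ∃ y : Y k, Filter.Tendsto (u k ∘ φ) Filter.atTop (nhds y) := by
  choose ψ hψ hlim using h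
  let Φ : ℕ → ℕ → ℕ := fun k => Nat.rec id (fun k φ => φ ∘ ψ k φ) k
  have hsucc : ∀ k, Φ (k + 1) = Φ k ∘ ψ k (Φ k) := fun _ => rfl
  have hmono : ∀ k, StrictMono (Φ k) := by
    intro k
    induction k with
    | zero => exact strictMono_id
    | succ k ih => rw [hsucc]; exact ih.comp (hψ _ _)
  have hfactor : ∀ k j, ∃ ρ : ℕ → ℕ, StrictMono ρ ∧ Φ (k + j) = Φ k ∘ ρ := by
    intro k j
    induction j with
    | zero => exact ⟨id, strictMono_id, rfl⟩
    | succ j ih =>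
      obtain ⟨ρ, hρ, hΦ⟩ := ih
      refine ⟨ρ ∘ ψ (k + j) (Φ (k + j)), hρ.comp (hψ _ _), ?_⟩
      rw [← add_assoc, hsucc, ← Function.comp_assoc, ← hΦ]
  refine ⟨fun n => Φ n n, strictMono_nat_of_lt_succ fun n => ?_, fun k => ?_⟩
  · rw [hsucc]
    exact hmono n (Nat.lt_of_lt_of_le n.lt_succ_self ((hψ _ _).le_apply))
  · obtain ⟨y, hy⟩ := hlim k (Φ k)
    refine ⟨y, ?_⟩
    choose ρ hρ hΦ using hfactor (k + 1)
    have hρ_lim : Filter.Tendsto (fun n => ρ (n - (k + 1)) n) Filter.atTop Filter.atTop :=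
      Filter.tendsto_atTop_mono (fun n => (hρ _).le_apply) Filter.tendsto_id
    refine (hy.comp hρ_lim).congr' ?_
    filter_upwards [Filter.eventually_ge_atTop (k + 1)] with n hn
    have hn' := congrFun (hΦ (n - (k + 1))) n
    rw [Nat.add_sub_cancel' hn, hsucc] at hn'
    simp only [Function.comp_apply] at hn' ⊢
    rw [hn']

/-- The points of a product of dense sets which differ from a given point in only countably many
coordinates form a dense set. -/
theorem dense_sigmaProduct {A : Type*} {X : A → Type*} [∀ α, TopologicalSpace (X α)]
    {D : ∀ α, Set (X α)} (hD : ∀ α, Dense (D α)) {d : ∀ α, X α} (hd : ∀ α, d α ∈ D α) :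
    Dense {x : ∀ α, X α | (∀ α, x α ∈ D α) ∧ {α | x α ≠ d α}.Countable} := by
  classical
  rw [dense_iff_inter_open]
  rintro U hU ⟨y, hy⟩
  obtain ⟨I, v, hv, hvU⟩ := isOpen_pi_iff.mp hU y hy
  have hz : ∀ α, ∃ z ∈ D α, (α ∈ I → z ∈ v α) ∧ (α ∉ I → z = d α) := by
    intro α
    by_cases hα : α ∈ I
    · obtain ⟨z, hzv, hzD⟩ := (hD α).inter_open_nonempty _ (hv α hα).1 ⟨_, (hv α hα).2⟩
      exact ⟨z, hzD, fun _ => hzv, fun h => absurd hα h⟩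
    · exact ⟨d α, hd α, fun h => absurd h hα, fun _ => rfl⟩
  choose z hzD hzv hzd using hz
  refine ⟨z, hvU fun α hα => hzv α hα, hzD, I.countable_toSet.mono fun α hα => ?_⟩
  by_contra hI
  exact hα (hzd α hI)

theorem product_of_sequentially_pracompact {A : Type*} {X : A → Type*}
    [∀ α, TopologicalSpace (X α)] (h : ∀ α, SeqPracompact (X α)) :
    SeqPracompact (∀ α, X α) := by
  choose D hD hseq using h
  rcases isEmpty_or_nonempty (∀ α, X α) with hX | ⟨⟨p⟩⟩
  · exact ⟨Set.univ, dense_univ, fun u => (hX.false (u 0)).elim⟩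
  have hne : ∀ α, (D α).Nonempty := fun α => by
    have : Nonempty (X α) := ⟨p α⟩
    exact (hD α).nonempty
  choose d hd using hne
  refine ⟨_, dense_sigmaProduct hD hd, fun u hu => ?_⟩
  rcases isEmpty_or_nonempty A with hA | hA
  · exact ⟨id, strictMono_id, p, tendsto_pi_nhds.mpr fun α => hA.elim α⟩
  obtain ⟨f, hf⟩ := Set.countable_iff_exists_subset_range.mp
    (Set.countable_iUnion fun n => (hu n).2)
  obtain ⟨φ, hφ, hlim⟩ := exists_strictMono_forall_tendsto (fun k n => u n (f k))
    fun k φ => hseq (f k) (fun n => u (φ n) (f k)) fun n => (hu (φ n)).1 (f k)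
  have hconv : ∀ α, ∃ x, Filter.Tendsto (fun n => u (φ n) α) Filter.atTop (nhds x) := by
    intro α
    by_cases hα : α ∈ Set.range f
    · obtain ⟨k, rfl⟩ := hα
      exact hlim k
    · have hconst : ∀ n, u n α = d α := fun n => by
        by_contra hn
        exact hα (hf (Set.mem_iUnion.mpr ⟨n, hn⟩))
      exact ⟨d α, by simp only [hconst]; exact tendsto_const_nhds⟩
  choose x hx using hconv
  exact ⟨φ, hφ, x, tendsto_pi_nhds.mpr hx⟩
end

section
/- Let $\{X_\alpha\}_{\alpha\in A}$ be a family of topological spaces each of which is sequentially pracompact, let $y=(y_\alpha)$ be a point of the product $\prod_{\alpha\in A} X_\alpha$, and let $Y=\{x\in\prod_{\alpha\in A} X_\alpha : \{\alpha\in A : x_\alpha\ne y_\alpha\}\text{ is countable}\}$ with the subspace topology. Then $Y$ is sequentially pracompact. -/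
open Filter Topology in
/-- Diagonal argument: if countably many sequences have convergent subsequences along every
subsequence, they converge simultaneously along one subsequence. -/
theorem exists_strictMono_forall_tendsto_of_countable {ι : Type*} [Countable ι] {X : ι → Type*}
    [∀ i, TopologicalSpace (X i)] (u : ∀ i, ℕ → X i)
    (hu : ∀ i, ∀ φ : ℕ → ℕ, StrictMono φ → ∃ ψ : ℕ → ℕ, StrictMono ψ ∧
      ∃ x, Tendsto (u i ∘ φ ∘ ψ) atTop (𝓝 x)) :
    ∃ φ : ℕ → ℕ, StrictMono φ ∧ ∀ i, ∃ x, Tendsto (u i ∘ φ) atTop (𝓝 x) := by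
  rcases isEmpty_or_nonempty ι with hι | hι
  · exact ⟨id, strictMono_id, fun i => hι.elim i⟩
  obtain ⟨e, he⟩ := exists_surjective_nat ι
  choose! ψ hψ hlim using hu
  let Φ : ℕ → ℕ → ℕ := fun n => Nat.rec id (fun k φ => φ ∘ ψ (e k) φ) n
  have hsucc : ∀ k, Φ (k + 1) = Φ k ∘ ψ (e k) (Φ k) := fun _ => rfl
  have hmono : ∀ k, StrictMono (Φ k) := by
    intro k
    induction k with
    | zero => exact strictMono_id
    | succ k ih => exact ih.comp (hψ _ _ ih)
  have hfactor : ∀ k n, k ≤ n → ∃ s : ℕ → ℕ, StrictMono s ∧ Φ n = Φ k ∘ s := by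
    intro k n hkn
    induction n, hkn using Nat.le_induction with
    | base => exact ⟨id, strictMono_id, rfl⟩
    | succ n _ ih =>
      obtain ⟨s, hs, hsn⟩ := ih
      refine ⟨s ∘ ψ (e n) (Φ n), hs.comp (hψ _ _ (hmono n)), ?_⟩
      rw [hsucc, ← Function.comp_assoc, ← hsn]
  refine ⟨fun n => Φ n n, strictMono_nat_of_lt_succ fun n => ?_, fun i => ?_⟩
  · rw [hsucc]
    exact hmono n ((Nat.lt_succ_self n).trans_le ((hψ _ _ (hmono n)).le_apply))
  · obtain ⟨k, rfl⟩ := he i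
    obtain ⟨x, hx⟩ := hlim (e k) (Φ k) (hmono k)
    refine ⟨x, fun U hU => ?_⟩
    obtain ⟨N, hN⟩ := mem_atTop_sets.1 (hx hU)
    refine mem_atTop_sets.2 ⟨max N (k + 1), fun n hn => ?_⟩
    obtain ⟨s, hs, hsn⟩ := hfactor (k + 1) n ((le_max_right _ _).trans hn)
    have hmem := hN (s n) (((le_max_left _ _).trans hn).trans hs.le_apply)
    change u (e k) (Φ n n) ∈ U
    rw [hsn]
    exact hmem

open Filter Topology in
/-- Adding a point to a set preserves the existence of convergent subsequences. -/
theorem exists_strictMono_tendsto_of_mem_insert {X : Type*} [TopologicalSpace X] {D : Set X}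
    (hD : ∀ u : ℕ → X, (∀ n, u n ∈ D) →
      ∃ φ : ℕ → ℕ, StrictMono φ ∧ ∃ x : X, Tendsto (u ∘ φ) atTop (𝓝 x))
    {y : X} {u : ℕ → X} (hu : ∀ n, u n ∈ insert y D) :
    ∃ φ : ℕ → ℕ, StrictMono φ ∧ ∃ x : X, Tendsto (u ∘ φ) atTop (𝓝 x) := by
  by_cases hy : ∃ᶠ n in atTop, u n = y
  · obtain ⟨φ, hφ, hφy⟩ := extraction_of_frequently_atTop hy
    exact ⟨φ, hφ, y, tendsto_const_nhds.congr fun n => (hφy n).symm⟩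
  · obtain ⟨φ, hφ, hφy⟩ := extraction_of_eventually_atTop (not_frequently.1 hy)
    obtain ⟨ψ, hψ, x, hx⟩ := hD (u ∘ φ) fun n => (hu (φ n)).resolve_left (hφy n)
    exact ⟨φ ∘ ψ, hφ.comp hψ, x, hx⟩

theorem sigma_product_of_sequentially_pracompact {A : Type*} {X : A → Type*}
    [∀ α, TopologicalSpace (X α)] (h : ∀ α, SeqPracompact (X α)) (y : ∀ α, X α) :
    SeqPracompact {x : ∀ α, X α | {α : A | x α ≠ y α}.Countable} := by
  classical
  choose D hdense hseq using h
  refine ⟨{x | ∀ α, x.1 α ∈ insert (y α) (D α)}, ?_, fun u hu => ?_⟩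
  · intro x
    rw [mem_closure_iff]
    rintro _ ⟨U, hU, rfl⟩ hxU
    obtain ⟨F, V, hV, hVU⟩ := isOpen_pi_iff.1 hU x.1 hxU
    have hex : ∀ α : F, ∃ d ∈ D α, d ∈ V α := fun α =>
      let ⟨d, hdV, hdD⟩ := (hdense α).inter_open_nonempty (V α) (hV α α.2).1 ⟨_, (hV α α.2).2⟩
      ⟨d, hdD, hdV⟩
    choose d hdD hdV using hex
    refine ⟨⟨fun α => if hα : α ∈ F then d ⟨α, hα⟩ else y α, ?_⟩, ?_, ?_⟩
    · refine F.countable_toSet.mono fun α hα => ?_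
      by_contra hF
      exact hα (dif_neg hF)
    · refine hVU fun α hα => ?_
      have hα' : α ∈ F := hα
      simpa [hα'] using hdV ⟨α, hα'⟩
    · intro α
      by_cases hα : α ∈ F
      · simpa [hα] using Or.inr (hdD ⟨α, hα⟩)
      · simp [hα]
  · let C : Set A := ⋃ n, {α | (u n).1 α ≠ y α}
    have hC : C.Countable := Set.countable_iUnion fun n => (u n).2
    have hyC : ∀ α ∉ C, ∀ n, (u n).1 α = y α := fun α hα n => by
      by_contra hne
      exact hα (Set.mem_iUnion.2 ⟨n, hne⟩)
    have : Countable C := hC.to_subtype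
    obtain ⟨φ, hφ, hlim⟩ := exists_strictMono_forall_tendsto_of_countable
      (fun (α : C) n => (u n).1 α) fun α φ _ =>
        exists_strictMono_tendsto_of_mem_insert (hseq α) fun n => hu (φ n) α
    choose z hz using hlim
    refine ⟨φ, hφ, ⟨fun α => if hα : α ∈ C then z ⟨α, hα⟩ else y α, ?_⟩, ?_⟩
    · refine hC.mono fun α hα => ?_
      by_contra hαC
      exact hα (dif_neg hαC)
    · rw [tendsto_subtype_rng, tendsto_pi_nhds]
      intro α
      by_cases hα : α ∈ C
      · simpa only [dif_pos hα, Function.comp_def] using hz ⟨α, hα⟩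
      · simp only [dif_neg hα]
        exact tendsto_const_nhds.congr fun n => (hyC α hα (φ n)).symm
end

section
/- Let $\{X_\alpha\}_{\alpha\in A}$ be a family of $T_1$ topological spaces each of which is totally countably pracompact. Then the product space $\prod_{\alpha\in A} X_\alpha$ is totally countably pracompact. -/
def TotallyCountablyPracompact (X : Type*) [TopologicalSpace X] : Prop :=
  ∃ D : Set X, Dense D ∧ ∀ u : ℕ → X, (∀ n, u n ∈ D) →
    ∃ φ : ℕ → ℕ, StrictMono φ ∧ IsCompact (closure (Set.range (u ∘ φ)))

/-- Diagonalization: countably many properties of infinite subsets of `ℕ`, each attainable by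
passing to a smaller infinite set and each inherited by almost-subsets, hold simultaneously for
the range of some strictly increasing sequence. -/
theorem exists_strictMono_forall_range (P : ℕ → Set ℕ → Prop)
    (hex : ∀ k, ∀ S : Set ℕ, S.Infinite → ∃ T ⊆ S, T.Infinite ∧ P k T)
    (hmono : ∀ k, ∀ S T : Set ℕ, P k T → (S \ T).Finite → P k S) :
    ∃ φ : ℕ → ℕ, StrictMono φ ∧ ∀ k, P k (Set.range φ) := by
  choose F hFsub hFinf hFP using hex
  let R : ℕ → {S : Set ℕ // S.Infinite} := fun n =>
    Nat.rec ⟨Set.univ, Set.infinite_univ⟩ (fun k S => ⟨F k S.1 S.2, hFinf k S.1 S.2⟩) n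
  have hanti : Antitone fun n => (R n).1 :=
    antitone_nat_of_succ_le fun n => hFsub n (R n).1 (R n).2
  obtain ⟨φ, hφ, hφR⟩ := Filter.extraction_forall_of_frequently
    (P := fun n m => m ∈ (R n).1) fun n => Nat.frequently_atTop_iff_infinite.2 (R n).2
  refine ⟨φ, hφ, fun k => hmono k _ (R (k + 1)).1 (hFP k (R k).1 (R k).2) ?_⟩
  refine ((Set.finite_lt_nat (k + 1)).image φ).subset ?_
  rintro _ ⟨⟨n, rfl⟩, hn⟩
  refine ⟨n, ?_, rfl⟩
  by_contra hlt
  exact hn (hanti (not_lt.1 hlt) (hφR n))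

theorem isCompact_closure_image_of_finite_diff {X ι : Type*} [TopologicalSpace X] [T1Space X]
    {f : ι → X} {S T : Set ι} (hT : IsCompact (closure (f '' T))) (hST : (S \ T).Finite) :
    IsCompact (closure (f '' S)) := by
  have hfin := hST.image f
  refine (hfin.isCompact.union hT).of_isClosed_subset isClosed_closure ?_
  refine closure_minimal ?_ (hfin.isClosed.union isClosed_closure)
  rintro _ ⟨n, hn, rfl⟩
  by_cases h : n ∈ T
  · exact Or.inr (subset_closure ⟨n, h, rfl⟩)
  · exact Or.inl ⟨n, ⟨hn, h⟩, rfl⟩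

theorem exists_infinite_subset_isCompact_closure_image {X : Type*} [TopologicalSpace X]
    {D : Set X} (hD : ∀ u : ℕ → X, (∀ n, u n ∈ D) →
      ∃ φ : ℕ → ℕ, StrictMono φ ∧ IsCompact (closure (Set.range (u ∘ φ))))
    {u : ℕ → X} (hu : ∀ n, u n ∈ D) {S : Set ℕ} (hS : S.Infinite) :
    ∃ T ⊆ S, T.Infinite ∧ IsCompact (closure (u '' T)) := by
  obtain ⟨ψ, hψ, hc⟩ := hD (u ∘ Nat.nth (· ∈ S)) fun n => hu _
  refine ⟨Set.range (Nat.nth (· ∈ S) ∘ ψ), ?_, ?_, ?_⟩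
  · rintro _ ⟨n, rfl⟩
    exact Nat.nth_mem_of_infinite hS _
  · exact Set.infinite_range_of_injective ((Nat.nth_strictMono hS).comp hψ).injective
  · rwa [← Set.range_comp, ← Function.comp_assoc]

theorem product_of_totally_countably_pracompact {A : Type*} {X : A → Type*}
    [∀ α, TopologicalSpace (X α)] [∀ α, T1Space (X α)]
    (h : ∀ α, TotallyCountablyPracompact (X α)) :
    TotallyCountablyPracompact (∀ α, X α) := by
  rcases isEmpty_or_nonempty A with hA | hA
  · exact ⟨Set.univ, dense_univ, fun u _ => ⟨id, strictMono_id, (Set.toFinite _).isCompact⟩⟩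
  rcases isEmpty_or_nonempty (∀ α, X α) with hX | ⟨⟨x⟩⟩
  · exact ⟨Set.univ, dense_univ, fun u _ => isEmptyElim (u 0)⟩
  choose D hD hDc using h
  have hne : ∀ α, ∃ y, y ∈ D α := fun α =>
    haveI : Nonempty (X α) := ⟨x α⟩
    (hD α).nonempty
  choose d hd using hne
  refine ⟨_, dense_sigmaProduct hD hd, fun u hu => ?_⟩
  obtain ⟨g, hg⟩ := Set.countable_iff_exists_subset_range.1
    (Set.countable_iUnion fun n => (hu n).2)
  obtain ⟨φ, hφ, hc⟩ := exists_strictMono_forall_range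
    (fun k S => IsCompact (closure ((fun n => u n (g k)) '' S)))
    (fun k S hS => exists_infinite_subset_isCompact_closure_image (hDc (g k))
      (fun n => (hu n).1 (g k)) hS)
    (fun k S T hT hST => isCompact_closure_image_of_finite_diff hT hST)
  have hcoord : ∀ α, IsCompact (closure ((fun n => u n α) '' Set.range φ)) := by
    intro α
    by_cases hα : α ∈ Set.range g
    · obtain ⟨k, rfl⟩ := hα
      exact hc k
    · have hconst : ∀ n, u n α = d α := fun n => by
        by_contra hn
        exact hα (hg (Set.mem_iUnion.2 ⟨n, hn⟩))
      have hfin : ((fun n => u n α) '' Set.range φ).Finite :=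
        (Set.finite_singleton (d α)).subset (by rintro _ ⟨n, -, rfl⟩; exact hconst n)
      rw [hfin.isClosed.closure_eq]
      exact hfin.isCompact
  refine ⟨φ, hφ, (isCompact_univ_pi hcoord).of_isClosed_subset isClosed_closure ?_⟩
  refine closure_minimal ?_ (isClosed_set_pi fun α _ => isClosed_closure)
  rintro _ ⟨n, rfl⟩ α -
  exact subset_closure ⟨φ n, ⟨n, rfl⟩, rfl⟩
end

section
/- Let $\{X_\alpha\}_{\alpha\in A}$ be a family of $T_1$ topological spaces each of which is totally countably pracompact, let $y=(y_\alpha)$ be a point of the product $\prod_{\alpha\in A} X_\alpha$, and let $Y=\{x\in\prod_{\alpha\in A} X_\alpha : \{\alpha\in A : x_\alpha\ne y_\alpha\}\text{ is countable}\}$ with the subspace topology. Then $Y$ is totally countably pracompact. -/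
open Filter Topology in
/-- A diagonal argument: if for each of countably many `i` every infinite set of natural numbers
has an infinite subset satisfying `P i`, then some sequence is, for every `i`, eventually in a
set satisfying `P i`. -/
theorem exists_strictMono_forall_eventually_mem {ι : Type*} [Countable ι]
    {P : ι → Set ℕ → Prop}
    (step : ∀ i, ∀ S : Set ℕ, S.Infinite → ∃ T ⊆ S, T.Infinite ∧ P i T) :
    ∃ φ : ℕ → ℕ, StrictMono φ ∧ ∀ i, ∃ T, P i T ∧ ∀ᶠ k in atTop, φ k ∈ T := by
  rcases isEmpty_or_nonempty ι with hι | hι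
  · exact ⟨id, strictMono_id, fun i => isEmptyElim i⟩
  obtain ⟨f, hf⟩ := exists_surjective_nat ι
  choose! R hRS hRinf hRP using step
  let S : ℕ → Set ℕ := fun n => Nat.rec Set.univ (fun k T => R (f k) T) n
  have hSinf : ∀ n, (S n).Infinite := by
    intro n
    induction n with
    | zero => exact Set.infinite_univ
    | succ k ih => exact hRinf (f k) _ ih
  have hSanti : Antitone S := antitone_nat_of_succ_le fun k => hRS (f k) _ (hSinf k)
  obtain ⟨φ, hφ, hφS⟩ : ∃ φ : ℕ → ℕ, StrictMono φ ∧ ∀ k, φ k ∈ S k :=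
    extraction_forall_of_frequently fun k => Nat.frequently_atTop_iff_infinite.2 (hSinf k)
  refine ⟨φ, hφ, fun i => ?_⟩
  obtain ⟨n, rfl⟩ := hf i
  refine ⟨S (n + 1), hRP (f n) _ (hSinf n), ?_⟩
  filter_upwards [eventually_ge_atTop (n + 1)] with k hk
  exact hSanti hk (hφS k)

/-- Adding a closed point to a set, each of whose sequences has a subsequence with compact closure,
preserves this property, also along an infinite set of indices. -/
theorem exists_infinite_isCompact_closure_image {X : Type*} [TopologicalSpace X] [T1Space X]
    {D : Set X}
    (hD : ∀ u : ℕ → X, (∀ n, u n ∈ D) →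
      ∃ φ : ℕ → ℕ, StrictMono φ ∧ IsCompact (closure (Set.range (u ∘ φ))))
    {y : X} {u : ℕ → X} (hu : ∀ n, u n ∈ insert y D) {S : Set ℕ} (hS : S.Infinite) :
    ∃ T ⊆ S, T.Infinite ∧ IsCompact (closure (u '' T)) := by
  by_cases hy : (S ∩ {n | u n = y}).Infinite
  · refine ⟨_, Set.inter_subset_left, hy, ?_⟩
    have hsub : closure (u '' (S ∩ {n | u n = y})) ⊆ {y} := by
      refine closure_minimal ?_ isClosed_singleton
      rintro _ ⟨n, hn, rfl⟩
      exact hn.2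
    exact isCompact_singleton.of_isClosed_subset isClosed_closure hsub
  · have hT : (S \ {n | u n = y}).Infinite := fun hfin =>
      hS (Set.inter_union_sdiff S {n | u n = y} ▸ (Set.not_infinite.1 hy).union hfin)
    have hmem := Nat.nth_mem_of_infinite hT
    obtain ⟨φ, hφ, hc⟩ := hD (fun n => u (Nat.nth (· ∈ S \ {n | u n = y}) n))
      fun n => (hu _).resolve_left (hmem n).2
    refine ⟨Set.range fun n => Nat.nth (· ∈ S \ {n | u n = y}) (φ n), ?_,
      Set.infinite_range_of_injective ((Nat.nth_injective hT).comp hφ.injective), ?_⟩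
    · rintro _ ⟨n, rfl⟩
      exact (hmem _).1
    · rwa [← Set.range_comp]

open Filter in
/-- In a `T1` space, compactness of the closure of a sequence only depends on its tail. -/
theorem isCompact_closure_range_of_eventually_mem {X : Type*} [TopologicalSpace X] [T1Space X]
    {v : ℕ → X} {K : Set X} (hK : IsCompact (closure K)) (hv : ∀ᶠ k in atTop, v k ∈ K) :
    IsCompact (closure (Set.range v)) := by
  obtain ⟨N, hN⟩ := eventually_atTop.1 hv
  have hfin : (v '' Set.Iio N).Finite := (Set.finite_Iio N).image v
  refine (hfin.isCompact.union hK).of_isClosed_subset isClosed_closure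
    (closure_minimal ?_ (hfin.isClosed.union isClosed_closure))
  rintro _ ⟨k, rfl⟩
  rcases lt_or_ge k N with hk | hk
  · exact Or.inl ⟨k, hk, rfl⟩
  · exact Or.inr (subset_closure (hN k hk))

theorem dense_sigma_product {A : Type*} {X : A → Type*} [∀ α, TopologicalSpace (X α)]
    {y : ∀ α, X α} {E : ∀ α, Set (X α)} (hE : ∀ α, Dense (E α)) (hy : ∀ α, y α ∈ E α) :
    Dense {x : {x : ∀ α, X α | {α : A | x α ≠ y α}.Countable} | ∀ α, x.1 α ∈ E α} := by
  classical
  refine dense_iff_inter_open.2 ?_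
  rintro _ ⟨V, hV, rfl⟩ ⟨x, hx⟩
  obtain ⟨I, hI⟩ := exists_finset_piecewise_mem_of_mem_nhds (hV.mem_nhds hx) y
  have hcont : Continuous fun z : ∀ α, X α => I.piecewise z y := by
    refine continuous_pi fun α => ?_
    by_cases hα : α ∈ I
    · simpa [hα] using continuous_apply α
    · simpa [hα] using continuous_const
  obtain ⟨z, hzV, hzE⟩ := (dense_pi Set.univ fun α _ => hE α).inter_open_nonempty _
    (hV.preimage hcont) ⟨x.1, hI⟩
  refine ⟨⟨I.piecewise z y, I.countable_toSet.mono fun α hα => ?_⟩, hzV, fun α => ?_⟩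
  · by_contra hαI
    exact hα (Finset.piecewise_eq_of_notMem _ _ _ hαI)
  · by_cases hα : α ∈ I
    · simpa [hα] using hzE α trivial
    · simpa [hα] using hy α

theorem sigma_product_of_totally_countably_pracompact {A : Type*} {X : A → Type*}
    [∀ α, TopologicalSpace (X α)] [∀ α, T1Space (X α)]
    (h : ∀ α, TotallyCountablyPracompact (X α)) (y : ∀ α, X α) :
    TotallyCountablyPracompact {x : ∀ α, X α | {α : A | x α ≠ y α}.Countable} := by
  choose D hDdense hD using h
  refine ⟨_, dense_sigma_product (E := fun α => insert (y α) (D α))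
    (fun α => (hDdense α).mono (Set.subset_insert _ _)) (fun α => Set.mem_insert _ _),
    fun u hu => ?_⟩
  let C : Set A := ⋃ n, {α | (u n).1 α ≠ y α}
  have hC : C.Countable := Set.countable_iUnion fun n => (u n).2
  have hyC : ∀ α ∉ C, ∀ n, (u n).1 α = y α := by
    intro α hα n
    by_contra hne
    exact hα (Set.mem_iUnion.2 ⟨n, hne⟩)
  have : Countable C := hC
  obtain ⟨φ, hφ, hT⟩ := exists_strictMono_forall_eventually_mem
    (P := fun (α : C) T => IsCompact (closure ((fun n => (u n).1 α.1) '' T)))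
    fun α S hS => exists_infinite_isCompact_closure_image (hD α.1) (fun n => hu n α.1) hS
  let K : ∀ α, Set (X α) := fun α => closure (Set.range fun k => (u (φ k)).1 α)
  have hKy : ∀ α ∉ C, K α ⊆ {y α} := by
    intro α hα
    refine closure_minimal ?_ isClosed_singleton
    rintro _ ⟨k, rfl⟩
    exact hyC α hα _
  have hK : ∀ α, IsCompact (K α) := by
    intro α
    by_cases hα : α ∈ C
    · obtain ⟨T, hTc, hev⟩ := hT ⟨α, hα⟩
      exact isCompact_closure_range_of_eventually_mem hTc
        (hev.mono fun k hk => Set.mem_image_of_mem _ hk)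
    · exact isCompact_singleton.of_isClosed_subset isClosed_closure (hKy α hα)
  have hKsub : Set.univ.pi K ⊆
      Set.range ((↑) : {x : ∀ α, X α | {α : A | x α ≠ y α}.Countable} → ∀ α, X α) := by
    intro x hx
    rw [Subtype.range_coe]
    refine hC.mono fun α hα => ?_
    by_contra hαC
    exact hα (hKy α hαC (hx α trivial))
  refine ⟨φ, hφ, (Topology.IsInducing.subtypeVal.isCompact_preimage'
    (isCompact_univ_pi hK) hKsub).of_isClosed_subset isClosed_closure (closure_minimal ?_
      ((isClosed_set_pi fun α _ => isClosed_closure).preimage continuous_subtype_val))⟩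
  rintro _ ⟨k, rfl⟩ α -
  exact subset_closure ⟨k, rfl⟩
end

section
/- Let $\{X_\alpha\}_{\alpha\in A}$ be a family of topological spaces each of which is $\omega$-bounded-pracompact. Then the product space $\prod_{\alpha\in A} X_\alpha$ is $\omega$-bounded-pracompact. -/
def OmegaBoundedPracompact (X : Type*) [TopologicalSpace X] : Prop :=
  ∃ D : Set X, Dense D ∧ ∀ C : Set X, C ⊆ D → C.Countable → IsCompact (closure C)

theorem product_of_omega_bounded_pracompact {A : Type*} {X : A → Type*}
    [∀ α, TopologicalSpace (X α)] (h : ∀ α, OmegaBoundedPracompact (X α)) :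
    OmegaBoundedPracompact (∀ α, X α) := by
  choose D hD hC using h
  refine ⟨Set.univ.pi D, dense_pi Set.univ fun α _ => hD α, fun C hCD hcount => ?_⟩
  have hcompact : IsCompact (Set.univ.pi fun α => closure (Function.eval α '' C)) :=
    isCompact_univ_pi fun α => hC α _
      (Set.image_subset_iff.2 fun x hx => hCD hx α (Set.mem_univ α)) (hcount.image _)
  refine hcompact.of_isClosed_subset isClosed_closure (closure_minimal ?_ ?_)
  · exact fun x hx α _ => subset_closure (Set.mem_image_of_mem _ hx)
  · exact isClosed_set_pi fun α _ => isClosed_closure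
end

section
/- Let $\{X_\alpha\}_{\alpha\in A}$ be a family of topological spaces each of which is sequentially feebly compact, let $y=(y_\alpha)$ be a point of the product $\prod_{\alpha\in A} X_\alpha$, and let $Y=\{x\in\prod_{\alpha\in A} X_\alpha : \{\alpha\in A : x_\alpha\ne y_\alpha\}\text{ is countable}\}$ with the subspace topology. Then $Y$ is sequentially feebly compact. (This uses the known fact that arbitrary products of sequentially feebly compact spaces are sequentially feebly compact, which may be assumed.) -/
def SeqFeeblyCompact (X : Type*) [TopologicalSpace X] : Prop :=
  ∀ U : ℕ → Set X, (∀ n, IsOpen (U n)) → (∀ n, (U n).Nonempty) →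
    ∃ (x : X) (I : Set ℕ), I.Infinite ∧
      ∀ V ∈ nhds x, {n ∈ I | U n ∩ V = ∅}.Finite

/-- In a sequentially feebly compact space, a subsequence of a sequence of nonempty open sets
indexed by any prescribed infinite set has a sequential accumulation point. -/
theorem SeqFeeblyCompact.exists_infinite_subset {X : Type*} [TopologicalSpace X]
    (h : SeqFeeblyCompact X) {U : ℕ → Set X} (hU : ∀ n, IsOpen (U n))
    (hne : ∀ n, (U n).Nonempty) {I : Set ℕ} (hI : I.Infinite) :
    ∃ J ⊆ I, J.Infinite ∧ ∃ x : X, ∀ V ∈ nhds x, {n ∈ J | U n ∩ V = ∅}.Finite := by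
  obtain ⟨x, K, hK, hx⟩ := h (fun k => U (Nat.nth (· ∈ I) k)) (fun _ => hU _) (fun _ => hne _)
  refine ⟨Nat.nth (· ∈ I) '' K, ?_, hK.image (Nat.nth_injective hI).injOn, x, fun V hV => ?_⟩
  · rintro _ ⟨k, -, rfl⟩
    exact Nat.nth_mem_of_infinite hI k
  · refine ((hx V hV).image (Nat.nth (· ∈ I))).subset ?_
    rintro _ ⟨⟨k, hk, rfl⟩, hkV⟩
    exact ⟨k, ⟨hk, hkV⟩, rfl⟩

/-- Diagonal argument: countably many properties of sets of natural numbers, each stable under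
almost inclusion and each attained by some infinite subset of any given infinite set, are attained
simultaneously by some infinite set. -/
theorem Set.Infinite.exists_forall_of_diagonal {ι : Type*} [Countable ι] {P : ι → Set ℕ → Prop}
    (hsub : ∀ i, ∀ I : Set ℕ, I.Infinite → ∃ J ⊆ I, J.Infinite ∧ P i J)
    (hmono : ∀ i, ∀ I J : Set ℕ, P i J → (I \ J).Finite → P i I) :
    ∃ I : Set ℕ, I.Infinite ∧ ∀ i, P i I := by
  rcases isEmpty_or_nonempty ι with hι | hι
  · exact ⟨Set.univ, Set.infinite_univ, fun i => isEmptyElim i⟩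
  obtain ⟨e, he⟩ := exists_surjective_nat ι
  choose! J hJI hJ hPJ using hsub
  let K : ℕ → Set ℕ := fun k => Nat.rec Set.univ (fun m S => J (e m) S) k
  have hK : ∀ k, (K k).Infinite := by
    intro k
    induction k with
    | zero => exact Set.infinite_univ
    | succ m ih => exact hJ (e m) (K m) ih
  have hanti : Antitone K := antitone_nat_of_succ_le fun m => hJI (e m) (K m) (hK m)
  obtain ⟨φ, hφ, hφK⟩ := Filter.extraction_forall_of_frequently
    (P := fun k n => n ∈ K k) fun k => Nat.frequently_atTop_iff_infinite.2 (hK k)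
  refine ⟨Set.range φ, Set.infinite_range_of_injective hφ.injective, fun i => ?_⟩
  obtain ⟨k, rfl⟩ := he i
  refine hmono (e k) _ (K (k + 1)) (hPJ (e k) (K k) (hK k)) ?_
  refine ((Set.finite_Iio (k + 1)).image φ).subset ?_
  rintro _ ⟨⟨m, rfl⟩, hm⟩
  refine ⟨m, ?_, rfl⟩
  by_contra hkm
  exact hm (hanti (not_lt.1 hkm) (hφK m))

theorem IsOpen.exists_finset_pi_subset {A : Type*} {X : A → Type*} [∀ α, TopologicalSpace (X α)]
    {O : Set (∀ α, X α)} (hO : IsOpen O) {p : ∀ α, X α} (hp : p ∈ O) :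
    ∃ (F : Finset A) (W : ∀ α, Set (X α)), (∀ α, IsOpen (W α)) ∧ (∀ α, p α ∈ W α) ∧
      (∀ α ∉ F, W α = Set.univ) ∧ Set.univ.pi W ⊆ O := by
  classical
  obtain ⟨F, u, hu, hF⟩ := isOpen_pi_iff.1 hO p hp
  refine ⟨F, fun α => if α ∈ F then u α else Set.univ, fun α => ?_, fun α => ?_,
    fun α hα => if_neg hα, fun z hz => hF fun α hα => ?_⟩
  · by_cases hα : α ∈ F
    · simpa [hα] using (hu α hα).1
    · simp [hα]
  · by_cases hα : α ∈ F
    · simpa [hα] using (hu α hα).2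
    · simp [hα]
  · simpa [Finset.mem_coe.1 hα] using hz α (Set.mem_univ α)

theorem sigma_product_of_sequentially_feebly_compact {A : Type*} {X : A → Type*}
    [∀ α, TopologicalSpace (X α)] (h : ∀ α, SeqFeeblyCompact (X α)) (y : ∀ α, X α) :
    SeqFeeblyCompact {x : ∀ α, X α | {α : A | x α ≠ y α}.Countable} := by
  classical
  intro U hU hne
  choose p hp using hne
  choose O hO hOU using fun n => isOpen_induced_iff.1 (hU n)
  have hpO : ∀ n, (p n : ∀ α, X α) ∈ O n := fun n => by
    have := hp n
    rwa [← hOU n] at this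
  choose F W hW hpW hWF hWO using fun n => (hO n).exists_finset_pi_subset (hpO n)
  let C : Set A := ⋃ n, (F n : Set A)
  have hC : C.Countable := Set.countable_iUnion fun n => (F n).countable_toSet
  have : Countable C := hC.to_subtype
  obtain ⟨I, hI, hIC⟩ := Set.Infinite.exists_forall_of_diagonal
    (P := fun (c : C) J => ∃ x : X c, ∀ V ∈ nhds x, {n ∈ J | W n c ∩ V = ∅}.Finite)
    (fun c I hI => (h c).exists_infinite_subset (fun n => hW n c) (fun n => ⟨_, hpW n c⟩) hI)
    (by
      rintro c I J ⟨x, hx⟩ hIJ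
      refine ⟨x, fun V hV => ((hx V hV).union hIJ).subset ?_⟩
      rintro n ⟨hn, hnV⟩
      by_cases hnJ : n ∈ J
      · exact Or.inl ⟨hnJ, hnV⟩
      · exact Or.inr ⟨hn, hnJ⟩)
  choose x hx using hIC
  let z : ∀ α, X α := fun α => if hα : α ∈ C then x ⟨α, hα⟩ else y α
  have hzC : ∀ α ∉ C, z α = y α := fun α hα => dif_neg hα
  have hz : {α | z α ≠ y α}.Countable :=
    hC.mono fun α hα => by_contra fun hαC => hα (hzC α hαC)
  have hzW : ∀ α, ∀ V ∈ nhds (z α), {n ∈ I | W n α ∩ V = ∅}.Finite := by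
    intro α V hV
    by_cases hα : α ∈ C
    · have hzx : z α = x ⟨α, hα⟩ := dif_pos hα
      rw [hzx] at hV
      exact hx ⟨α, hα⟩ V hV
    · refine Set.finite_empty.subset ?_
      rintro n ⟨-, hn⟩
      rw [hWF n α fun hαF => hα (Set.mem_iUnion.2 ⟨n, hαF⟩), Set.univ_inter] at hn
      exact (hn ▸ mem_of_mem_nhds hV : z α ∈ (∅ : Set (X α)))
  refine ⟨⟨z, hz⟩, I, hI, fun V hV => ?_⟩
  obtain ⟨V', hV', hVV'⟩ := mem_nhds_subtype _ _ _ |>.1 hV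
  obtain ⟨O', hO'V, hO', hzO'⟩ := mem_nhds_iff.1 hV'
  obtain ⟨G, T, hT, hzT, hTG, hTO⟩ := hO'.exists_finset_pi_subset hzO'
  refine (G.finite_toSet.biUnion fun α _ =>
    hzW α (T α) ((hT α).mem_nhds (hzT α))).subset ?_
  rintro n ⟨hn, hnV⟩
  by_contra hcon
  have hmeet : ∀ α ∈ G, (W n α ∩ T α).Nonempty := fun α hα =>
    Set.nonempty_iff_ne_empty.2 fun he => hcon (Set.mem_biUnion (Finset.mem_coe.2 hα) ⟨hn, he⟩)
  choose w hw using hmeet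
  let q : ∀ α, X α := fun α => if hα : α ∈ G then w α hα else (p n : ∀ α, X α) α
  have hqpos : ∀ α (hα : α ∈ G), q α = w α hα := fun α hα => dif_pos hα
  have hqneg : ∀ α ∉ G, q α = (p n : ∀ α, X α) α := fun α hα => dif_neg hα
  have hq : {α | q α ≠ y α}.Countable := by
    refine (G.countable_toSet.union (p n).2).mono fun α hα => ?_
    by_cases hαG : α ∈ G
    · exact Or.inl hαG
    · exact Or.inr (by rwa [Set.mem_ofPred_eq, hqneg α hαG] at hα)
  have hqU : (⟨q, hq⟩ : {x : ∀ α, X α | {α : A | x α ≠ y α}.Countable}) ∈ U n := by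
    rw [← hOU n]
    refine hWO n fun α _ => ?_
    change q α ∈ W n α
    by_cases hα : α ∈ G
    · rw [hqpos α hα]
      exact (hw α hα).1
    · rw [hqneg α hα]
      exact hpW n α
  have hqV : (⟨q, hq⟩ : {x : ∀ α, X α | {α : A | x α ≠ y α}.Countable}) ∈ V := by
    refine hVV' (hO'V (hTO fun α _ => ?_))
    change q α ∈ T α
    by_cases hα : α ∈ G
    · rw [hqpos α hα]
      exact (hw α hα).2
    · rw [hTG α hα]
      exact Set.mem_univ _
  exact (Set.eq_empty_iff_forall_notMem.1 hnV _) ⟨hqU, hqV⟩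
end

section
/- Every Fréchet–Urysohn feebly compact topological space is sequentially feebly compact. -/
def FrechetUrysohn (X : Type*) [TopologicalSpace X] : Prop :=
  ∀ (S : Set X) (x : X), x ∈ closure S →
    ∃ u : ℕ → X, (∀ n, u n ∈ S) ∧ Filter.Tendsto u Filter.atTop (nhds x)

def FeeblyCompact (X : Type*) [TopologicalSpace X] : Prop :=
  ∀ 𝒰 : Set (Set X), (∀ U ∈ 𝒰, IsOpen U ∧ U.Nonempty) →
    LocallyFinite (fun U : 𝒰 => (U : Set X)) → 𝒰.Finite

/-- In a feebly compact space, a sequence of nonempty open sets is not locally finite. -/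
theorem FeeblyCompact.not_locallyFinite {X : Type*} [TopologicalSpace X]
    (hfc : FeeblyCompact X) {U : ℕ → Set X} (hU : ∀ n, IsOpen (U n))
    (hne : ∀ n, (U n).Nonempty) : ¬ LocallyFinite U := by
  intro hlf
  have hfin : (Set.range U).Finite := by
    refine hfc _ ?_ hlf.on_range
    rintro _ ⟨n, rfl⟩
    exact ⟨hU n, hne n⟩
  have : Finite (Set.range U) := hfin
  obtain ⟨⟨_, m, rfl⟩, hm⟩ := Finite.exists_infinite_fiber (Set.rangeFactorization U)
  obtain ⟨x, hx⟩ := hne m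
  refine Set.infinite_coe_iff.mp hm ((hlf.point_finite x).subset fun n hn => ?_)
  have hnm : U n = U m := congrArg Subtype.val hn
  exact hnm.superset hx

theorem frechetUrysohn_feeblyCompact_implies_seqFeeblyCompact {X : Type*}
    [TopologicalSpace X] (hFU : FrechetUrysohn X) (hfc : FeeblyCompact X) :
    SeqFeeblyCompact X := by
  intro U hU hne
  obtain ⟨x, hx⟩ : ∃ x, ∀ V ∈ nhds x, {n | (U n ∩ V).Nonempty}.Infinite := by
    by_contra! h
    refine hfc.not_locallyFinite hU hne fun x => ?_
    exact h x
  by_cases hcl : {n | x ∈ closure (U n)}.Infinite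
  · refine ⟨x, _, hcl, fun V hV => Set.finite_empty.subset ?_⟩
    rintro n ⟨hn, hempty⟩
    have h := mem_closure_iff_nhds.mp hn V hV
    rw [Set.inter_comm, hempty] at h
    exact Set.not_nonempty_empty h
  · rw [Set.not_infinite] at hcl
    have hmem : x ∈ closure (⋃ n ∈ {n | x ∉ closure (U n)}, U n) := by
      refine mem_closure_iff_nhds.mpr fun V hV => ?_
      obtain ⟨n, ⟨y, hyU, hyV⟩, hn⟩ := ((hx V hV).sdiff hcl).nonempty
      exact ⟨y, hyV, Set.mem_biUnion hn hyU⟩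
    obtain ⟨u, hu, hlim⟩ := hFU _ x hmem
    simp only [Set.mem_iUnion, exists_prop] at hu
    choose k hk huk using hu
    refine ⟨x, Set.range k, fun hfin => ?_, fun V hV => ?_⟩
    · have : Finite (Set.range k) := hfin
      obtain ⟨⟨_, m, rfl⟩, hm⟩ := Finite.exists_infinite_fiber (Set.rangeFactorization k)
      refine hk m (mem_closure_of_frequently_of_tendsto ?_ hlim)
      refine (Nat.frequently_atTop_iff_infinite.mpr (Set.infinite_coe_iff.mp hm)).mono ?_
      intro j hj
      have hjm : k j = k m := congrArg Subtype.val hj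
      exact hjm ▸ huk j
    · have hev : {j | u j ∉ V}.Finite := by
        have h : ∀ᶠ j in Filter.cofinite, u j ∈ V := by
          rw [Nat.cofinite_eq_atTop]
          exact hlim hV
        exact h
      refine (hev.image k).subset ?_
      rintro _ ⟨⟨j, rfl⟩, hempty⟩
      exact ⟨j, fun hj => Set.eq_empty_iff_forall_notMem.mp hempty _ ⟨huk j, hj⟩, rfl⟩
end

section
/- Every Fréchet–Urysohn feebly compact quasiregular topological space is selectively sequentially feebly compact. -/
def Quasiregular (X : Type*) [TopologicalSpace X] : Prop :=
  ∀ U : Set X, IsOpen U → U.Nonempty →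
    ∃ V : Set X, IsOpen V ∧ V.Nonempty ∧ closure V ⊆ U

def SelSeqFeeblyCompact (X : Type*) [TopologicalSpace X] : Prop :=
  ∀ U : ℕ → Set X, (∀ n, IsOpen (U n)) → (∀ n, (U n).Nonempty) →
    ∃ x : ℕ → X, (∀ n, x n ∈ U n) ∧
      ∃ (φ : ℕ → ℕ) (p : X), StrictMono φ ∧ Filter.Tendsto (x ∘ φ) Filter.atTop (nhds p)

open Filter Topology

/-- It suffices to select points along a sequence of indices tending to infinity. -/
theorem exists_selection_of_tendsto_atTop {X : Type*} [TopologicalSpace X] {U : ℕ → Set X}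
    (hU : ∀ n, (U n).Nonempty) {i : ℕ → ℕ} (hi : Tendsto i atTop atTop) {y : ℕ → X} {p : X}
    (hy : ∀ k, y k ∈ U (i k)) (hp : Tendsto y atTop (𝓝 p)) :
    ∃ x : ℕ → X, (∀ n, x n ∈ U n) ∧
      ∃ (φ : ℕ → ℕ) (p : X), StrictMono φ ∧ Tendsto (x ∘ φ) atTop (𝓝 p) := by
  obtain ⟨θ, hθ, hiθ⟩ := strictMono_subseq_of_tendsto_atTop hi
  choose z hz using hU
  refine ⟨Function.extend (i ∘ θ) (y ∘ θ) z, fun n => ?_, i ∘ θ, p, hiθ, ?_⟩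
  · by_cases hn : ∃ k, (i ∘ θ) k = n
    · obtain ⟨k, rfl⟩ := hn
      rw [hiθ.injective.extend_apply]
      exact hy _
    · rw [Function.extend_apply' _ _ _ hn]
      exact hz n
  · rw [Function.extend_comp hiθ.injective]
    exact hp.comp hθ.tendsto_atTop

theorem FeeblyCompact.not_locallyFinite_s8 {X : Type*} [TopologicalSpace X] (hX : FeeblyCompact X)
    {ι : Type*} [Infinite ι] {V : ι → Set X} (hVo : ∀ n, IsOpen (V n))
    (hVn : ∀ n, (V n).Nonempty) : ¬ LocallyFinite V := by
  intro hV
  have hfin : (Set.range V).Finite :=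
    hX _ (Set.forall_mem_range.2 fun n => ⟨hVo n, hVn n⟩) hV.on_range
  have : Finite (Set.range V) := hfin
  obtain ⟨⟨_, m, rfl⟩, hm⟩ := Finite.exists_infinite_fiber (Set.rangeFactorization V)
  obtain ⟨x, hx⟩ := hVn m
  refine Set.infinite_coe_iff.1 hm ((hV.point_finite x).subset fun n hn => ?_)
  have hn' : V n = V m := congrArg Subtype.val hn
  simpa [hn'] using hx

theorem frechetUrysohn_feeblyCompact_quasiregular_implies_selSeqFeeblyCompact {X : Type*}
    [TopologicalSpace X] (hFU : FrechetUrysohn X) (hfc : FeeblyCompact X)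
    (hqr : Quasiregular X) : SelSeqFeeblyCompact X := by
  intro U hUo hUn
  choose V hVo hVn hVU using fun n => hqr (U n) (hUo n) (hUn n)
  have hV := hfc.not_locallyFinite_s8 hVo hVn
  simp only [LocallyFinite, not_forall, not_exists, not_and] at hV
  obtain ⟨x, hx⟩ := hV
  by_cases hfreq : ∃ᶠ n in atTop, x ∈ closure (V n)
  · obtain ⟨φ, hφ, hxφ⟩ := extraction_of_frequently_atTop hfreq
    exact exists_selection_of_tendsto_atTop hUn hφ.tendsto_atTop
      (fun k => hVU _ (hxφ k)) tendsto_const_nhds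
  · obtain ⟨m, hm⟩ := eventually_atTop.1 (not_frequently.1 hfreq)
    have hcl : x ∈ closure (⋃ n ≥ m, V n) := by
      refine mem_closure_iff_nhds.2 fun W hW => ?_
      obtain ⟨n, ⟨y, hyV, hyW⟩, hn⟩ := Set.Infinite.exists_gt (hx W hW) m
      exact ⟨y, hyW, Set.mem_biUnion hn.le hyV⟩
    obtain ⟨y, hy, hyx⟩ := hFU _ x hcl
    simp only [Set.mem_iUnion, exists_prop] at hy
    choose i him hyi using hy
    refine exists_selection_of_tendsto_atTop hUn ?_
      (fun k => hVU _ (subset_closure (hyi k))) hyx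
    have hne (n : ℕ) : ∀ᶠ k in atTop, i k ≠ n := by
      by_cases hn : m ≤ n
      · have hnhds : (closure (V n))ᶜ ∈ 𝓝 x := isClosed_closure.isOpen_compl.mem_nhds (hm n hn)
        filter_upwards [hyx hnhds] with k hk hkn
        exact hk (subset_closure (hkn ▸ hyi k))
      · exact .of_forall fun k hk => hn (hk ▸ him k)
    refine tendsto_atTop.2 fun b => ?_
    filter_upwards [(eventually_all_finite (Set.finite_lt_nat b)).2 fun n _ => hne n] with k hk
    exact not_lt.1 fun h => hk _ h rfl
end

section
/- Every Fréchet–Urysohn feebly compact topological space which is an $\alpha_7$-space is selectively sequentially feebly compact. -/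
def Alpha7Space (X : Type*) [TopologicalSpace X] : Prop :=
  ∀ (x : X) (S : ℕ → Set X),
    (∀ n, (S n).Countable ∧ (S n).Infinite) →
    (∀ n, ∀ U ∈ nhds x, (S n \ U).Finite) →
    ∃ (T : Set X) (y : X), T.Countable ∧ T.Infinite ∧
      (∀ V ∈ nhds y, (T \ V).Finite) ∧ {n : ℕ | (S n ∩ T).Nonempty}.Infinite

/-- Points chosen in infinitely many of the sets `U n` and converging to `p` along the cofinite
filter give a full selection with a convergent subsequence. -/
theorem exists_selection_of_finite_fibers {X : Type*} [TopologicalSpace X]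
    {U : ℕ → Set X} (hU : ∀ n, (U n).Nonempty) {M : Set ℕ} (hM : M.Infinite)
    {f : ℕ → ℕ} (hf : ∀ n, {k ∈ M | f k = n}.Finite) {x : ℕ → X}
    (hx : ∀ k ∈ M, x k ∈ U (f k)) {p : X}
    (hp : ∀ V ∈ nhds p, {k ∈ M | x k ∉ V}.Finite) :
    ∃ x : ℕ → X, (∀ n, x n ∈ U n) ∧
      ∃ (φ : ℕ → ℕ) (p : X), StrictMono φ ∧ Filter.Tendsto (x ∘ φ) Filter.atTop (nhds p) := by
  have hM' : (f '' M).Infinite := fun hfin =>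
    hM ((hfin.biUnion fun n _ => hf n).subset fun k hk =>
      Set.mem_biUnion (Set.mem_image_of_mem f hk) ⟨hk, rfl⟩)
  have hsel : ∀ n, ∃ z ∈ U n, n ∈ f '' M → ∃ k ∈ M, f k = n ∧ x k = z := by
    intro n
    by_cases hn : n ∈ f '' M
    · obtain ⟨k, hk, rfl⟩ := hn
      exact ⟨x k, hx k hk, fun _ => ⟨k, hk, rfl, rfl⟩⟩
    · exact ⟨_, (hU n).some_mem, fun h => absurd h hn⟩
  choose z hzU hz using hsel
  refine ⟨z, hzU, Nat.nth (· ∈ f '' M), p, Nat.nth_strictMono hM', fun V hV => ?_⟩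
  have hbad : {n ∈ f '' M | z n ∉ V}.Finite := by
    refine ((hp V hV).image f).subset ?_
    rintro n ⟨hn, hnV⟩
    obtain ⟨k, hk, hkn, hkz⟩ := hz n hn
    exact ⟨k, ⟨hk, hkz ▸ hnV⟩, hkn⟩
  rw [Filter.mem_map, ← Nat.cofinite_eq_atTop, Filter.mem_cofinite]
  refine (hbad.preimage (Nat.nth_strictMono hM').injective.injOn).subset ?_
  exact fun n hn => ⟨Nat.nth_mem_of_infinite hM' n, hn⟩

/-- In a feebly compact space every sequence of nonempty open sets accumulates at some point,
where indices are counted with repetition. -/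
theorem FeeblyCompact.exists_accumulation {X : Type*} [TopologicalSpace X]
    (hfc : FeeblyCompact X) {U : ℕ → Set X} (hUo : ∀ n, IsOpen (U n))
    (hU : ∀ n, (U n).Nonempty) :
    ∃ x : X, ∀ V ∈ nhds x, {n | (U n ∩ V).Nonempty}.Infinite := by
  by_contra! h
  have hfin : (Set.range U).Finite := by
    refine hfc _ (by rintro _ ⟨n, rfl⟩; exact ⟨hUo n, hU n⟩) fun x => ?_
    obtain ⟨V, hV, hVfin⟩ := h x
    refine ⟨V, hV, ?_⟩
    refine Set.Finite.of_finite_image ((hVfin.image U).subset ?_) Subtype.val_injective.injOn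
    rintro _ ⟨⟨_, n, rfl⟩, hn, rfl⟩
    exact ⟨n, hn, rfl⟩
  obtain ⟨⟨W, m, rfl⟩, hW⟩ : ∃ W : Set.range U, {n | Set.rangeFactorization U n = W}.Infinite := by
    have := hfin.to_subtype
    obtain ⟨W, hW⟩ := Finite.exists_infinite_fiber (Set.rangeFactorization U)
    exact ⟨W, Set.infinite_coe_iff.mp hW⟩
  obtain ⟨x, hx⟩ := hU m
  obtain ⟨V, hV, hVfin⟩ := h x
  refine hW (hVfin.subset fun n hn => ⟨x, ?_, mem_of_mem_nhds hV⟩)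
  have : U n = U m := congrArg Subtype.val hn
  rwa [this]

/-- In a Fréchet–Urysohn space, a point of the closure of `A` either has an element of `A` in all
of its neighbourhoods, or is the limit of a countably infinite subset of `A`. -/
theorem FrechetUrysohn.exists_mem_or_exists_infinite {X : Type*} [TopologicalSpace X]
    (hFU : FrechetUrysohn X) {A : Set X} {x : X} (hx : x ∈ closure A) :
    (∃ t ∈ A, ∀ V ∈ nhds x, t ∈ V) ∨
      ∃ S ⊆ A, (S.Countable ∧ S.Infinite) ∧ ∀ V ∈ nhds x, (S \ V).Finite := by
  obtain ⟨u, huA, hu⟩ := hFU A x hx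
  have hu' : ∀ V ∈ nhds x, {k | u k ∉ V}.Finite := by
    intro V hV
    have := hu hV
    rwa [Filter.mem_map, ← Nat.cofinite_eq_atTop, Filter.mem_cofinite] at this
  by_cases hfin : (Set.range u).Finite
  · left
    have := hfin.to_subtype
    obtain ⟨⟨_, m, rfl⟩, hm⟩ := Finite.exists_infinite_fiber (Set.rangeFactorization u)
    refine ⟨u m, huA m, fun V hV => ?_⟩
    by_contra hmV
    refine Set.infinite_coe_iff.mp hm ((hu' V hV).subset fun k hk => ?_)
    have : u k = u m := congrArg Subtype.val hk
    simpa [this] using hmV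
  · refine .inr ⟨_, Set.range_subset_iff.mpr huA, ⟨Set.countable_range u, hfin⟩, fun V hV => ?_⟩
    refine ((hu' V hV).image u).subset ?_
    rintro _ ⟨⟨k, rfl⟩, hk⟩
    exact ⟨k, hk, rfl⟩

theorem frechetUrysohn_feeblyCompact_alpha7_implies_selSeqFeeblyCompact {X : Type*}
    [TopologicalSpace X] (hFU : FrechetUrysohn X) (hfc : FeeblyCompact X)
    (ha : Alpha7Space X) : SelSeqFeeblyCompact X := by
  intro U hUo hU
  obtain ⟨x, hx⟩ := hfc.exists_accumulation hUo hU
  by_cases hC : {n | x ∈ closure (U n)}.Finite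
  · have hxA : x ∈ closure (⋃ n ∈ {n | x ∉ closure (U n)}, U n) := by
      rw [mem_closure_iff_nhds]
      intro V hV
      obtain ⟨n, ⟨z, hzU, hzV⟩, hn⟩ := ((hx V hV).sdiff hC).nonempty
      exact ⟨z, hzV, Set.mem_biUnion hn hzU⟩
    obtain ⟨u, huA, hu⟩ := hFU _ x hxA
    simp only [Set.mem_iUnion, exists_prop] at huA
    choose f hf huf using huA
    refine exists_selection_of_finite_fibers hU Set.infinite_univ (f := f) (x := u) (p := x)
      (fun n => ?_) (fun k _ => huf k) fun V hV => ?_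
    · by_contra hinf
      have hfreq : ∃ᶠ k in Filter.atTop, f k = n := by
        rw [Nat.frequently_atTop_iff_infinite]
        simpa using hinf
      obtain ⟨k, rfl⟩ := hfreq.exists
      exact hf k (mem_closure_of_frequently_of_tendsto (hfreq.mono fun j hj => hj ▸ huf j) hu)
    · have := hu hV
      rw [Filter.mem_map, ← Nat.cofinite_eq_atTop, Filter.mem_cofinite] at this
      exact this.subset fun k hk => hk.2
  · by_cases hM : {n | ∃ t ∈ U n, ∀ V ∈ nhds x, t ∈ V}.Infinite
    · have hsel : ∀ n, ∃ t, n ∈ {n | ∃ t ∈ U n, ∀ V ∈ nhds x, t ∈ V} →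
          t ∈ U n ∧ ∀ V ∈ nhds x, t ∈ V := fun n => by
        by_cases hn : n ∈ {n | ∃ t ∈ U n, ∀ V ∈ nhds x, t ∈ V}
        · exact hn.imp fun t ht _ => ht
        · exact ⟨x, fun h => absurd h hn⟩
      choose t ht using hsel
      refine exists_selection_of_finite_fibers hU hM (f := id) (x := t) (p := x)
        (fun n => (Set.finite_singleton n).subset fun k hk => hk.2) (fun k hk => (ht k hk).1)
        fun V hV => Set.finite_empty.subset fun k hk => hk.2 ((ht k hk.1).2 V hV)
    have hN := Set.Infinite.sdiff hC (Set.not_infinite.mp hM)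
    have hφ := Nat.nth_strictMono hN
    have hφN := Nat.nth_mem_of_infinite hN
    set φ := Nat.nth (· ∈ {n | x ∈ closure (U n)} \ {n | ∃ t ∈ U n, ∀ V ∈ nhds x, t ∈ V})
    choose S hSU hS hSx using fun k =>
      (hFU.exists_mem_or_exists_infinite (hφN k).1).resolve_left (hφN k).2
    obtain ⟨T, y, -, -, hT, hK⟩ := ha x S hS hSx
    have hsel : ∀ k, ∃ t, (S k ∩ T).Nonempty → t ∈ S k ∩ T := fun k => by
      by_cases hk : (S k ∩ T).Nonempty
      · exact hk.imp fun t ht _ => ht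
      · exact ⟨x, fun h => absurd h hk⟩
    choose t ht using hsel
    by_cases hrep : ∃ z, {k ∈ {k | (S k ∩ T).Nonempty} | t k = z}.Infinite
    · obtain ⟨z, hz⟩ := hrep
      refine exists_selection_of_finite_fibers hU hz (f := φ) (x := t) (p := z)
        (fun n => ?_) (fun k hk => hSU k (ht k hk.1).1) fun V hV => ?_
      · exact ((Set.finite_singleton n).preimage hφ.injective.injOn).subset fun k hk => hk.2
      · exact Set.finite_empty.subset fun k hk => hk.2 (hk.1.2 ▸ mem_of_mem_nhds hV)
    · simp only [not_exists, Set.not_infinite] at hrep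
      refine exists_selection_of_finite_fibers hU hK (f := φ) (x := t) (p := y)
        (fun n => ?_) (fun k hk => hSU k (ht k hk).1) fun V hV => ?_
      · exact ((Set.finite_singleton n).preimage hφ.injective.injOn).subset fun k hk => hk.2
      · exact ((hT V hV).biUnion fun z _ => hrep z).subset fun k hk =>
          Set.mem_biUnion ⟨(ht k hk.1).2, hk.2⟩ ⟨hk.1, rfl⟩
end

section
/- Every countably pracompact $k$-space (i.e., a Hausdorff compactly generated space) is totally countably pracompact. -/
def CountablyPracompact (X : Type*) [TopologicalSpace X] : Prop :=
  ∃ D : Set X, Dense D ∧ ∀ B : Set X, B ⊆ D → B.Infinite →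
    ∃ x : X, ∀ U ∈ nhds x, ∃ b ∈ B, b ∈ U ∧ b ≠ x

/-- In a Hausdorff space whose closed sets are detected by compact subsets, a set with an
accumulation point has infinite intersection with some compact set. -/
theorem exists_isCompact_infinite_inter {X : Type*} [TopologicalSpace X] [T2Space X]
    (hk : ∀ F : Set X, (∀ K : Set X, IsCompact K → IsClosed ((fun k : K => (k : X)) ⁻¹' F)) →
      IsClosed F)
    {B : Set X} {x : X} (hx : ∀ U ∈ nhds x, ∃ b ∈ B, b ∈ U ∧ b ≠ x) :
    ∃ K : Set X, IsCompact K ∧ (B ∩ K).Infinite := by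
  by_contra! hfin
  have hclosed : IsClosed (B \ {x}) := by
    refine hk _ fun K hK => Set.Finite.isClosed ?_
    refine Set.Finite.of_finite_image ((hfin K hK).subset ?_) Subtype.val_injective.injOn
    rintro _ ⟨k, hkB, rfl⟩
    exact ⟨hkB.1, k.2⟩
  obtain ⟨b, hb, hbU, hbx⟩ := hx _ (hclosed.isOpen_compl.mem_nhds fun hxB => hxB.2 rfl)
  exact hbU ⟨hb, hbx⟩

/-- A sequence that visits a compact set infinitely often has a subsequence whose range has
compact closure. -/
theorem exists_strictMono_isCompact_closure_range {X : Type*} [TopologicalSpace X] [T2Space X]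
    {u : ℕ → X} {K : Set X} (hK : IsCompact K) (hu : (u ⁻¹' K).Infinite) :
    ∃ φ : ℕ → ℕ, StrictMono φ ∧ IsCompact (closure (Set.range (u ∘ φ))) := by
  obtain ⟨φ, hφ, hφK⟩ := Filter.extraction_of_frequently_atTop
    (Nat.frequently_atTop_iff_infinite.mpr hu)
  exact ⟨φ, hφ, hK.closure_of_subset (Set.range_subset_iff.mpr hφK)⟩

theorem countablyPracompact_kSpace_implies_totallyCountablyPracompact {X : Type*}
    [TopologicalSpace X] [T2Space X]
    (hk : ∀ F : Set X, IsClosed F ↔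
      ∀ K : Set X, IsCompact K → IsClosed ((fun k : K => (k : X)) ⁻¹' F))
    (h : CountablyPracompact X) : TotallyCountablyPracompact X := by
  obtain ⟨D, hD, hacc⟩ := h
  refine ⟨D, hD, fun u hu => ?_⟩
  by_cases hfin : (Set.range u).Finite
  · refine exists_strictMono_isCompact_closure_range hfin.isCompact ?_
    rw [Set.preimage_range]
    exact Set.infinite_univ
  · obtain ⟨x, hx⟩ := hacc _ (Set.range_subset_iff.mpr hu) hfin
    obtain ⟨K, hK, hinf⟩ := exists_isCompact_infinite_inter (fun F => (hk F).mpr) hx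
    refine exists_strictMono_isCompact_closure_range hK (Set.Infinite.of_image u ?_)
    rwa [Set.image_preimage_eq_range_inter]
end

section
/- Every sequentially feebly compact topological space which contains a dense set of isolated points is sequentially pracompact. -/
theorem seqFeeblyCompact_denseIsolated_implies_seqPracompact {X : Type*}
    [TopologicalSpace X] (h : SeqFeeblyCompact X)
    (D : Set X) (hD : Dense D) (hiso : ∀ p ∈ D, IsOpen ({p} : Set X)) :
    SeqPracompact X := by
  refine ⟨D, hD, fun u hu => ?_⟩
  obtain ⟨x, I, hI, hx⟩ := h (fun n => {u n}) (fun n => hiso _ (hu n))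
    (fun n => Set.singleton_nonempty _)
  have hmono : StrictMono (Nat.nth (· ∈ I)) := Nat.nth_strictMono hI
  refine ⟨Nat.nth (· ∈ I), hmono, x, fun V hV => ?_⟩
  rw [Filter.mem_map, ← Nat.cofinite_eq_atTop, Filter.mem_cofinite]
  refine ((hx V hV).preimage hmono.injective.injOn).subset fun k hk => ?_
  exact ⟨Nat.nth_mem_of_infinite hI k, Set.singleton_inter_eq_empty.mpr hk⟩
end

section
/- Selective sequential feeble compactness is preserved by extensions: if $X$ is a dense subspace of a topological space $Y$ and $X$ (with the subspace topology) is selectively sequentially feebly compact, then $Y$ is selectively sequentially feebly compact. -/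
theorem selSeqFeeblyCompact_of_denseSubspace {Y : Type*} [TopologicalSpace Y]
    (X : Set Y) (hX : Dense X) (h : SelSeqFeeblyCompact X) :
    SelSeqFeeblyCompact Y := by
  intro U hUo hUne
  obtain ⟨x, hx, φ, p, hφ, hlim⟩ := h (fun n => Subtype.val ⁻¹' U n)
    (fun n => (hUo n).preimage continuous_subtype_val)
    (fun n => by
      obtain ⟨y, hyU, hyX⟩ := hX.inter_open_nonempty (U n) (hUo n) (hUne n)
      exact ⟨⟨y, hyX⟩, hyU⟩)
  exact ⟨fun n => x n, hx, φ, p, hφ, (continuous_subtype_val.tendsto p).comp hlim⟩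
end

section
/- $\omega$-bounded-pracompactness is preserved by continuous Hausdorff images: if $f\colon X\to Y$ is a continuous surjection of topological spaces, $Y$ is Hausdorff, and $X$ is $\omega$-bounded-pracompact, then $Y$ is $\omega$-bounded-pracompact. -/
theorem omegaBoundedPracompact_of_continuous_surjection {X Y : Type*}
    [TopologicalSpace X] [TopologicalSpace Y] [T2Space Y] (f : X → Y)
    (hf : Continuous f) (hsurj : Function.Surjective f)
    (h : OmegaBoundedPracompact X) : OmegaBoundedPracompact Y := by
  obtain ⟨D, hD, hcompact⟩ := h
  refine ⟨f '' D, hsurj.denseRange.dense_image hf hD, fun C hC hCc => ?_⟩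
  obtain ⟨B, hBD, hB⟩ := Set.SurjOn.exists_bijOn_subset hC
  have hBc : B.Countable :=
    Set.countable_of_injective_of_countable_image hB.injOn (hB.image_eq ▸ hCc)
  have hK : IsCompact (f '' closure B) := (hcompact B hBD hBc).image hf
  refine hK.closure_of_subset ?_
  rw [← hB.image_eq]
  exact Set.image_mono subset_closure
end
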